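/- arXiv:1009.3052 — 6 statements merged into one kernel-verified Lean document; each statement's English description precedes it below -/
import Mathlib

section
/- Let P ≥ 1, Q > 0, Δ > 0 be real numbers and let ρ = ρ*(P,Q). Then R⁺(P,Q,Δ) − R⁻(P,Q,Δ,ρ) ≤ 1/2. -/
/-- Upper bound `R⁺` (in bits per symbol) on the secret-key capacity of the
Gaussian wiretap channel with state. -/
noncomputable def Rplus (P Q Δ : ℝ) : ℝ :=
  (1 / 2) * Real.logb 2
    (1 + Δ * (P + Q + 2 * Real.sqrt (P * Q)) / (P + Q + 1 + Δ + 2 * Real.sqrt (P * Q)))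

/-- Lower bound `R⁻` (in bits per symbol) on the secret-key capacity of the
Gaussian wiretap channel with state. -/
noncomputable def Rminus (P Q Δ ρ : ℝ) : ℝ :=
  (1 / 2) * Real.logb 2
    (1 + Δ * (P + Q + 2 * ρ * Real.sqrt (P * Q)) / (P + Q + 1 + Δ + 2 * ρ * Real.sqrt (P * Q)))

/-- The unique nonnegative solution `ρ*(P,Q)` of `P·(1−ρ²) = 1 − 1/(P+Q+1)`. -/
noncomputable def rhoStar (P Q : ℝ) : ℝ :=
  Real.sqrt (1 - (1 - 1 / (P + Q + 1)) / P)

/-- The rate argument `1 + Δ x / (x + 1 + Δ)` at most doubles when `x + 1` at most doubles. -/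
lemma one_add_mul_div_le_two_mul {A B Δ : ℝ} (hA : 0 ≤ A) (hB : 0 ≤ B) (hΔ : 0 < Δ)
    (h : A + 1 ≤ 2 * (B + 1)) :
    1 + Δ * A / (A + 1 + Δ) ≤ 2 * (1 + Δ * B / (B + 1 + Δ)) := by
  have factor (x : ℝ) (hx : 0 ≤ x) :
      1 + Δ * x / (x + 1 + Δ) = (x + 1) * (1 + Δ) / (x + 1 + Δ) := by
    have : x + 1 + Δ ≠ 0 := by positivity
    field_simp
    ring
  rw [factor A hA, factor B hB, ← mul_div_assoc, div_le_div_iff₀ (by positivity) (by positivity)]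
  have key : (A + 1) * (B + 1 + Δ) ≤ 2 * (B + 1) * (A + 1 + Δ) := by
    nlinarith [mul_le_mul_of_nonneg_right h hΔ.le, mul_nonneg hA hB]
  nlinarith [mul_le_mul_of_nonneg_right key (by positivity : 0 ≤ 1 + Δ)]

lemma two_mul_sqrt_mul_le_add {P Q : ℝ} (hP : 0 ≤ P) (hQ : 0 ≤ Q) :
    2 * Real.sqrt (P * Q) ≤ P + Q := by
  rw [Real.sqrt_mul hP]
  nlinarith [sq_nonneg (Real.sqrt P - Real.sqrt Q), Real.sq_sqrt hP, Real.sq_sqrt hQ]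

/-- The gap between the upper and lower bounds is at most half a bit per symbol. -/
theorem gap_le_half (P Q Δ : ℝ) (hP : 1 ≤ P) (hQ : 0 < Q) (hΔ : 0 < Δ) :
    Rplus P Q Δ - Rminus P Q Δ (rhoStar P Q) ≤ 1 / 2 := by
  have hP0 : 0 ≤ P := by linarith
  have hρ : 0 ≤ rhoStar P Q := Real.sqrt_nonneg _
  have hs := two_mul_sqrt_mul_le_add hP0 hQ.le
  have hρs : 0 ≤ 2 * rhoStar P Q * Real.sqrt (P * Q) := by positivity
  have hA : 0 ≤ P + Q + 2 * Real.sqrt (P * Q) := by positivity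
  have hB : 0 ≤ P + Q + 2 * rhoStar P Q * Real.sqrt (P * Q) := by positivity
  have h := one_add_mul_div_le_two_mul hA hB hΔ (by linarith)
  have comm (x : ℝ) : P + Q + x + 1 + Δ = P + Q + 1 + Δ + x := by ring
  rw [comm, comm] at h
  have hlog := Real.logb_le_logb_of_le one_lt_two (by positivity) h
  rw [Real.logb_mul two_ne_zero (by positivity), Real.logb_self_eq_one one_lt_two] at hlog
  unfold Rplus Rminus
  linarith
end

section
/- Fix real numbers Q > 0 and Δ > 0. Then R⁺(P,Q,Δ) − R⁻(P,Q,Δ,ρ*(P,Q)) tends to 0 as P → ∞. -/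
/-- Along any diverging signal power `f`, the rate tends to the rate `logb 2 (1 + Δ) / 2`
of the noiseless limit. -/
theorem tendsto_rate_of_tendsto_atTop {α : Type*} {l : Filter α} {f : α → ℝ} {Δ : ℝ}
    (hΔ : 0 < Δ) (hf : Filter.Tendsto f l Filter.atTop) :
    Filter.Tendsto (fun a => (1 / 2) * Real.logb 2 (1 + Δ * f a / (f a + (1 + Δ)))) l
      (nhds ((1 / 2) * Real.logb 2 (1 + Δ))) := by
  have hinv : Filter.Tendsto (fun a => (f a + (1 + Δ))⁻¹) l (nhds 0) :=
    (Filter.tendsto_atTop_add_const_right l (1 + Δ) hf).inv_tendsto_atTop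
  have harg : Filter.Tendsto (fun a => 1 + Δ * f a / (f a + (1 + Δ))) l (nhds (1 + Δ)) := by
    have h := (hinv.const_mul (Δ * (1 + Δ))).const_sub (1 + Δ)
    rw [mul_zero, sub_zero] at h
    refine h.congr' ?_
    filter_upwards [hf.eventually_gt_atTop 0] with a ha
    have : f a + (1 + Δ) ≠ 0 := by positivity
    field_simp
    ring
  have hlog := (harg.log (by positivity)).div_const (Real.log 2)
  exact hlog.const_mul (1 / 2)

/-- The combined signal power diverges for any nonnegative correlation coefficient. -/
theorem tendsto_signalPower_atTop {Q : ℝ} (hQ : 0 ≤ Q) {ρ : ℝ → ℝ} (hρ : ∀ P, 0 ≤ ρ P) :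
    Filter.Tendsto (fun P => P + Q + 2 * ρ P * Real.sqrt (P * Q)) Filter.atTop Filter.atTop := by
  refine Filter.tendsto_atTop_mono (fun P => ?_) Filter.tendsto_id
  have := mul_nonneg (hρ P) (Real.sqrt_nonneg (P * Q))
  simp only [id]
  linarith

/-- The bounds coincide in the high-SNR regime: the gap tends to 0 as `P → ∞`. -/
theorem gap_tendsto_zero_highSNR (Q Δ : ℝ) (hQ : 0 < Q) (hΔ : 0 < Δ) :
    Filter.Tendsto (fun P : ℝ => Rplus P Q Δ - Rminus P Q Δ (rhoStar P Q))
      Filter.atTop (nhds 0) := by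
  have hplus := tendsto_rate_of_tendsto_atTop hΔ
    (tendsto_signalPower_atTop hQ.le (ρ := fun _ => 1) fun _ => zero_le_one)
  have hminus := tendsto_rate_of_tendsto_atTop hΔ
    (tendsto_signalPower_atTop hQ.le (ρ := fun P => rhoStar P Q) fun _ => Real.sqrt_nonneg _)
  have h := hplus.sub hminus
  rw [sub_self] at h
  refine h.congr fun P => ?_
  simp only [Rplus, Rminus, mul_one]
  ring_nf
end

section
/- Fix real numbers P ≥ 1 and Δ > 0. Then R⁺(P,Q,Δ) − R⁻(P,Q,Δ,ρ*(P,Q)) tends to 0 as Q → ∞. -/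
theorem Rplus_eq_Rminus_one (P Q Δ : ℝ) : Rplus P Q Δ = Rminus P Q Δ 1 := by
  simp [Rplus, Rminus]

theorem tendsto_mul_div_add_atTop (Δ c : ℝ) :
    Filter.Tendsto (fun x : ℝ => Δ * x / (x + c)) Filter.atTop (nhds Δ) := by
  have h : Filter.Tendsto (fun x : ℝ => Δ - Δ * c / (x + c)) Filter.atTop (nhds (Δ - 0)) :=
    tendsto_const_nhds.sub
      (tendsto_const_nhds.div_atTop (Filter.tendsto_atTop_add_const_right _ c Filter.tendsto_id))
  rw [sub_zero] at h
  refine h.congr' ?_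
  filter_upwards [Filter.eventually_gt_atTop (-c)] with x hx
  have : x + c ≠ 0 := by linarith
  field_simp
  ring

/-- With nonnegative correlation, `R⁻` tends to `(1/2)·log₂(1 + Δ)` as `Q → ∞`. -/
theorem tendsto_Rminus_atTop (P Δ : ℝ) (hΔ : 1 + Δ ≠ 0) (ρ : ℝ → ℝ) (hρ : ∀ Q, 0 ≤ ρ Q) :
    Filter.Tendsto (fun Q : ℝ => Rminus P Q Δ (ρ Q)) Filter.atTop
      (nhds ((1 / 2) * Real.logb 2 (1 + Δ))) := by
  have hx : Filter.Tendsto (fun Q : ℝ => P + Q + 2 * ρ Q * Real.sqrt (P * Q))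
      Filter.atTop Filter.atTop := by
    refine Filter.tendsto_atTop_mono (fun Q => ?_)
      (Filter.tendsto_atTop_add_const_left _ P Filter.tendsto_id)
    have := mul_nonneg (hρ Q) (Real.sqrt_nonneg (P * Q))
    simp only [id]
    linarith
  have h := ((tendsto_mul_div_add_atTop Δ (1 + Δ)).comp hx).const_add 1
  refine (((h.log hΔ).div_const (Real.log 2)).const_mul (1 / 2)).congr fun Q => ?_
  simp only [Rminus, Real.logb, Function.comp_apply]
  ring_nf

/-- The bounds coincide in the high-INR regime: the gap tends to 0 as `Q → ∞`. -/
theorem gap_tendsto_zero_highINR (P Δ : ℝ) (hP : 1 ≤ P) (hΔ : 0 < Δ) :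
    Filter.Tendsto (fun Q : ℝ => Rplus P Q Δ - Rminus P Q Δ (rhoStar P Q))
      Filter.atTop (nhds 0) := by
  have hΔ' : 1 + Δ ≠ 0 := by positivity
  simpa only [Rplus_eq_Rminus_one, sub_self] using
    (tendsto_Rminus_atTop P Δ hΔ' (fun _ => 1) fun _ => zero_le_one).sub
      (tendsto_Rminus_atTop P Δ hΔ' (rhoStar P) fun _ => Real.sqrt_nonneg _)
end

section
/- Fix real numbers Q > 0 and Δ > 0. Then R⁻(P,Q,Δ,ρ*(P,Q)) tends to (1/2)·log₂(1+Δ) as P → ∞. -/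
open Filter Topology in
theorem tendsto_mul_div_add_atTop_s5 (a b : ℝ) :
    Tendsto (fun x : ℝ => a * x / (x + b)) atTop (𝓝 a) := by
  have hden : Tendsto (fun x : ℝ => x + b) atTop atTop :=
    tendsto_atTop_add_const_right _ b tendsto_id
  have hlim : Tendsto (fun x : ℝ => a - a * b / (x + b)) atTop (𝓝 (a - 0)) :=
    tendsto_const_nhds.sub (hden.const_div_atTop (a * b))
  rw [sub_zero] at hlim
  refine hlim.congr' ?_
  filter_upwards [hden.eventually_gt_atTop 0] with x hx
  field_simp
  ring

open Filter Topology in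
/-- For any nonnegative correlation `ρ`, possibly depending on `P`, the bound `R⁻` tends to
`(1/2)·log₂(1+Δ)` as `P → ∞`. -/
theorem Rminus_tendsto_of_nonneg {Q Δ : ℝ} (hQ : 0 ≤ Q) (hΔ : 0 < Δ) {ρ : ℝ → ℝ}
    (hρ : ∀ P, 0 ≤ ρ P) :
    Tendsto (fun P : ℝ => Rminus P Q Δ (ρ P)) atTop (𝓝 ((1 / 2) * Real.logb 2 (1 + Δ))) := by
  have hpow : Tendsto (fun P : ℝ => P + Q + 2 * ρ P * Real.sqrt (P * Q)) atTop atTop := by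
    refine tendsto_atTop_mono (fun P => ?_) tendsto_id
    have : 0 ≤ 2 * ρ P * Real.sqrt (P * Q) :=
      mul_nonneg (mul_nonneg zero_le_two (hρ P)) (Real.sqrt_nonneg _)
    simp only [id]
    linarith
  have hfrac := ((tendsto_mul_div_add_atTop_s5 Δ (1 + Δ)).comp hpow).const_add 1
  refine ((hfrac.logb (b := 2) (by positivity)).const_mul (1 / 2)).congr fun P => ?_
  simp only [Rminus, Function.comp_apply]
  congr 4
  ring

/-- `R⁻(P,Q,Δ,ρ*(P,Q)) → (1/2)·log₂(1+Δ)` as `P → ∞`. -/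
theorem Rminus_tendsto_highSNR (Q Δ : ℝ) (hQ : 0 < Q) (hΔ : 0 < Δ) :
    Filter.Tendsto (fun P : ℝ => Rminus P Q Δ (rhoStar P Q))
      Filter.atTop (nhds ((1 / 2) * Real.logb 2 (1 + Δ))) :=
  Rminus_tendsto_of_nonneg hQ.le hΔ fun _ => Real.sqrt_nonneg _
end

section
/- Let P ≥ 1 and Q ≥ 0 be real numbers, and let ρ ∈ (−1, 0] satisfy P·(1−ρ²) = 1 − 1/(P+Q+1). Then P+Q+1+2·ρ·√(P·Q) > 0 and P·(1−ρ²) ≥ (P+Q+2·ρ·√(P·Q))/(P+Q+1+2·ρ·√(P·Q)). -/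
/-- Verification that `α = 1` satisfies the constraint `I(U;Yr) − I(U;S) ≥ 0`:
if `1 ≤ P`, `0 ≤ Q` and `ρ ∈ (−1, 0]` satisfies `P(1−ρ²) = 1 − 1/(P+Q+1)`, then
`P+Q+1+2ρ√(PQ) > 0` and `P(1−ρ²) ≥ (P+Q+2ρ√(PQ))/(P+Q+1+2ρ√(PQ))`. -/
theorem alpha_one_feasible (P Q ρ : ℝ) (hP : 1 ≤ P) (hQ : 0 ≤ Q)
    (hρ : ρ ∈ Set.Ioc (-1 : ℝ) 0)
    (hcons : P * (1 - ρ ^ 2) = 1 - 1 / (P + Q + 1)) :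
    0 < P + Q + 1 + 2 * ρ * Real.sqrt (P * Q) ∧
    P * (1 - ρ ^ 2)
      ≥ (P + Q + 2 * ρ * Real.sqrt (P * Q))
        / (P + Q + 1 + 2 * ρ * Real.sqrt (P * Q)) := by
  obtain ⟨hρ₁, hρ₀⟩ := hρ
  have hs : 0 ≤ √(P * Q) := Real.sqrt_nonneg _
  have hs_sq : √(P * Q) ^ 2 = P * Q := Real.sq_sqrt (by positivity)
  have h_amgm : 2 * √(P * Q) ≤ P + Q :=
    abs_le_of_sq_le_sq' (by nlinarith [sq_nonneg (P - Q)]) (by linarith) |>.2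
  have hpos : 0 < P + Q + 1 + 2 * ρ * √(P * Q) := by nlinarith
  refine ⟨hpos, ?_⟩
  have hle : P + Q + 1 + 2 * ρ * √(P * Q) ≤ P + Q + 1 := by nlinarith
  have hfrac : (P + Q + 2 * ρ * √(P * Q)) / (P + Q + 1 + 2 * ρ * √(P * Q))
      = 1 - 1 / (P + Q + 1 + 2 * ρ * √(P * Q)) := by
    rw [eq_sub_iff_add_eq, ← add_div, div_eq_one_iff_eq hpos.ne']
    ring
  rw [hcons, hfrac]
  exact sub_le_sub_left (one_div_le_one_div_of_le hpos hle) 1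
end

section
/- Let P > 0, Q ≥ 0, Δ > 0 be real numbers, let ρ be a real number with |ρ| < 1, and set s = √(P·Q) and A = P + Q + 2·ρ·s. For every real α, with B = P + α²·Q + 2·α·ρ·s and C = P·Q·(α−1)²·(1−ρ²), one has (1/2)·log₂((C + (1+Δ)·B)/(A+1+Δ)) − (1/2)·log₂((C + B)/(A+1)) ≤ (1/2)·log₂((1+Δ)·(A+1)/(A+1+Δ)), with equality when α = 1. -/
/-- The variance `P + α²Q + 2αρ√(PQ)` of `X + αS` is positive when `|ρ| < 1`. -/
theorem variance_add_mul_pos {P Q ρ : ℝ} (hP : 0 < P) (hQ : 0 ≤ Q) (hρ : |ρ| < 1) (α : ℝ) :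
    0 < P + α ^ 2 * Q + 2 * α * ρ * Real.sqrt (P * Q) := by
  have hρ2 : 0 < 1 - ρ ^ 2 := sub_pos.mpr ((sq_lt_one_iff_abs_lt_one ρ).mpr hρ)
  have hs : Real.sqrt (P * Q) ^ 2 = P * Q := Real.sq_sqrt (mul_nonneg hP.le hQ)
  set s := Real.sqrt (P * Q)
  have hscaled : P * (P + α ^ 2 * Q + 2 * α * ρ * s)
      = (P * ρ + α * s) ^ 2 + P ^ 2 * (1 - ρ ^ 2) := by
    linear_combination -α ^ 2 * hs
  refine pos_of_mul_pos_right ?_ hP.le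
  rw [hscaled]
  positivity

/-- The difference of two half base-two logarithms is the half logarithm of the quotient. -/
theorem half_logb_sub_half_logb {x y : ℝ} (hx : 0 < x) (hy : 0 < y) :
    (1 / 2) * Real.logb 2 x - (1 / 2) * Real.logb 2 y = (1 / 2) * Real.logb 2 (x / y) := by
  rw [Real.logb_div hx.ne' hy.ne']
  ring

theorem half_logb_sub_half_logb_le {A B C Δ : ℝ} (hA : 0 < A) (hB : 0 < B) (hC : 0 ≤ C)
    (hΔ : 0 < Δ) :
    (1 / 2) * Real.logb 2 ((C + (1 + Δ) * B) / (A + 1 + Δ))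
        - (1 / 2) * Real.logb 2 ((C + B) / (A + 1))
      ≤ (1 / 2) * Real.logb 2 ((1 + Δ) * (A + 1) / (A + 1 + Δ)) := by
  rw [half_logb_sub_half_logb (by positivity) (by positivity)]
  refine mul_le_mul_of_nonneg_left (Real.logb_le_logb_of_le one_lt_two (by positivity) ?_)
    (by norm_num)
  rw [div_le_iff₀ (by positivity),
      show (1 + Δ) * (A + 1) / (A + 1 + Δ) * ((C + B) / (A + 1))
        = (1 + Δ) * (C + B) / (A + 1 + Δ) by field_simp]
  gcongr
  nlinarith [mul_nonneg hΔ.le hC]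

theorem half_logb_sub_half_logb_eq {A Δ : ℝ} (hA : 0 < A) (hΔ : 0 < Δ) :
    (1 / 2) * Real.logb 2 ((1 + Δ) * A / (A + 1 + Δ)) - (1 / 2) * Real.logb 2 (A / (A + 1))
      = (1 / 2) * Real.logb 2 ((1 + Δ) * (A + 1) / (A + 1 + Δ)) := by
  rw [half_logb_sub_half_logb (by positivity) (by positivity)]
  congr 2
  field_simp

/-- The achievable Gaussian secret-key rate `R(α)` is maximized over `α` at
`α = 1`, where it equals `(1/2)·log₂((1+Δ)·(A+1)/(A+1+Δ))`. -/
theorem rate_maximized_at_alpha_one (P Q Δ ρ : ℝ) (hP : 0 < P) (hQ : 0 ≤ Q)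
    (hΔ : 0 < Δ) (hρ : |ρ| < 1) :
    (∀ α : ℝ,
      (1 / 2) * Real.logb 2
          ((P * Q * (α - 1) ^ 2 * (1 - ρ ^ 2)
              + (1 + Δ) * (P + α ^ 2 * Q + 2 * α * ρ * Real.sqrt (P * Q)))
            / (P + Q + 2 * ρ * Real.sqrt (P * Q) + 1 + Δ))
        - (1 / 2) * Real.logb 2
          ((P * Q * (α - 1) ^ 2 * (1 - ρ ^ 2)
              + (P + α ^ 2 * Q + 2 * α * ρ * Real.sqrt (P * Q)))
            / (P + Q + 2 * ρ * Real.sqrt (P * Q) + 1))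
      ≤ (1 / 2) * Real.logb 2
          ((1 + Δ) * (P + Q + 2 * ρ * Real.sqrt (P * Q) + 1)
            / (P + Q + 2 * ρ * Real.sqrt (P * Q) + 1 + Δ))) ∧
    ((1 / 2) * Real.logb 2
          ((P * Q * ((1 : ℝ) - 1) ^ 2 * (1 - ρ ^ 2)
              + (1 + Δ) * (P + 1 ^ 2 * Q + 2 * 1 * ρ * Real.sqrt (P * Q)))
            / (P + Q + 2 * ρ * Real.sqrt (P * Q) + 1 + Δ))
        - (1 / 2) * Real.logb 2
          ((P * Q * ((1 : ℝ) - 1) ^ 2 * (1 - ρ ^ 2)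
              + (P + 1 ^ 2 * Q + 2 * 1 * ρ * Real.sqrt (P * Q)))
            / (P + Q + 2 * ρ * Real.sqrt (P * Q) + 1))
      = (1 / 2) * Real.logb 2
          ((1 + Δ) * (P + Q + 2 * ρ * Real.sqrt (P * Q) + 1)
            / (P + Q + 2 * ρ * Real.sqrt (P * Q) + 1 + Δ))) := by
  have hA : 0 < P + Q + 2 * ρ * Real.sqrt (P * Q) := by
    simpa using variance_add_mul_pos hP hQ hρ 1
  have hρ2 : 0 ≤ 1 - ρ ^ 2 := sub_nonneg.mpr ((sq_le_one_iff_abs_le_one ρ).mpr hρ.le)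
  refine ⟨fun α => half_logb_sub_half_logb_le hA (variance_add_mul_pos hP hQ hρ α)
    (by positivity) hΔ, ?_⟩
  simpa using half_logb_sub_half_logb_eq hA hΔ
end
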